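/- For all integers n ≥ 1 and d ≥ 1, (d+1)·Σ_{τ∈S_n} L(τ)·d^{c(τ)} = (d+n)·∏_{i=0}^{n−1}(d+i). -/

import Mathlib

open Finset

/-- number of cycles of `τ`, counting fixed points as 1-cycles. -/
def cycCount {n : ℕ} (τ : Equiv.Perm (Fin n)) : ℕ :=
  τ.cycleType.card + (Finset.univ.filter fun x => τ x = x).card

/-- length of the cycle containing `x`, i.e. the size of the orbit of `x` under `τ`. -/
def orbLen {n : ℕ} (τ : Equiv.Perm (Fin n)) (x : Fin n) : ℕ :=
  (Finset.univ.filter fun y => τ.SameCycle x y).card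

open Equiv Equiv.Perm

theorem Equiv.Perm.SameCycle.rel_of_forall_rel_apply {α : Type*} [Finite α] {σ : Perm α}
    {r : α → α → Prop} (hrefl : ∀ x, r x x) (htrans : ∀ x y z, r x y → r y z → r x z)
    (h : ∀ x, r x (σ x)) {x y : α} (hxy : σ.SameCycle x y) : r x y := by
  obtain ⟨k, rfl⟩ := hxy.exists_nat_pow_eq
  clear hxy
  induction k with
  | zero => exact hrefl x
  | succ k ih =>
    rw [pow_succ']
    exact htrans _ _ _ ih (h _)

theorem cycCount_eq_card_quotient {n : ℕ} (τ : Perm (Fin n)) :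
    cycCount τ = Nat.card (Quotient (SameCycle.setoid τ)) := by
  let f : Fin n → τ.cycleFactorsFinset ⊕ {x // τ x = x} := fun x =>
    if h : τ x = x then .inr ⟨x, h⟩
    else .inl ⟨τ.cycleOf x, cycleOf_mem_cycleFactorsFinset_iff.2 (mem_support.2 h)⟩
  have hf : ∀ x y, τ.SameCycle x y ↔ f x = f y := by
    intro x y
    by_cases hx : τ x = x <;> by_cases hy : τ y = y
    · simp only [f, hx, hy, dite_true, Sum.inr.injEq, Subtype.mk.injEq]
      exact ⟨fun h => h.eq_of_left hx, fun h => h.sameCycle τ⟩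
    · simp only [f, hx, hy, dite_true, dite_false, reduceCtorEq, iff_false]
      exact fun h => hy (h.apply_eq_self_iff.1 hx)
    · simp only [f, hx, hy, dite_true, dite_false, reduceCtorEq, iff_false]
      exact fun h => hx (h.apply_eq_self_iff.2 hy)
    · simp only [f, hx, hy, dite_false, Sum.inl.injEq, Subtype.mk.injEq]
      exact sameCycle_iff_cycleOf_eq_of_mem_support (mem_support.2 hx) (mem_support.2 hy)
  have hsurj : Function.Surjective f := by
    rintro (⟨c, hc⟩ | ⟨x, hx⟩)
    · obtain ⟨x, hx⟩ := (mem_cycleFactorsFinset_iff.1 hc).1.nonempty_support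
      have hτx : τ x ≠ x := mem_support.1 (mem_cycleFactorsFinset_support_le hc hx)
      refine ⟨x, ?_⟩
      simp only [f, hτx, dite_false, Sum.inl.injEq, Subtype.mk.injEq]
      exact (cycle_is_cycleOf hx hc).symm
    · exact ⟨x, by simp [f, hx]⟩
  have hbij : Function.Bijective
      (Quotient.lift (s := SameCycle.setoid τ) f fun x y h => (hf x y).1 h) := by
    refine ⟨?_, fun c => (hsurj c).imp' (Quotient.mk _) fun _ h => h⟩
    rintro ⟨x⟩ ⟨y⟩ h
    exact Quotient.sound ((hf x y).2 h)
  rw [Nat.card_eq_of_bijective _ hbij, Nat.card_sum, cycCount, cycleType_def]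
  simp [Fintype.card_subtype]

section decomposeFin

variable {n : ℕ} (τ : Perm (Fin n))

theorem decomposeFin_symm_zero_apply_succ (x : Fin n) :
    decomposeFin.symm (0, τ) x.succ = (τ x).succ := by
  simp

theorem decomposeFin_symm_succ_apply_succ (q x : Fin n) :
    decomposeFin.symm (q.succ, τ) x.succ = if τ x = q then 0 else (τ x).succ := by
  rw [decomposeFin_symm_apply_succ]
  split_ifs with h
  · simp [h]
  · exact swap_apply_of_ne_of_ne (Fin.succ_ne_zero _) (by simpa using h)

theorem sameCycle_decomposeFin_symm_zero_succ_iff {x y : Fin n} :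
    (decomposeFin.symm (0, τ)).SameCycle x.succ y.succ ↔ τ.SameCycle x y := by
  refine ⟨fun h => ?_, fun h => ?_⟩
  · refine h.rel_of_forall_rel_apply
      (r := fun u v => ∀ x, u = Fin.succ x → ∃ y, v = Fin.succ y ∧ τ.SameCycle x y)
      ?_ ?_ ?_ x rfl |>.elim fun z hz => Fin.succ_injective _ hz.1 ▸ hz.2
    · exact fun u x hx => ⟨x, hx, .rfl⟩
    · intro u v w huv hvw x hx
      obtain ⟨y, hy, hxy⟩ := huv x hx
      obtain ⟨z, hz, hyz⟩ := hvw y hy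
      exact ⟨z, hz, hxy.trans hyz⟩
    · rintro _ x rfl
      exact ⟨τ x, decomposeFin_symm_zero_apply_succ τ x, sameCycle_apply_right.2 .rfl⟩
  · refine h.rel_of_forall_rel_apply
      (r := fun x y => (decomposeFin.symm (0, τ)).SameCycle x.succ y.succ)
      (fun _ => .rfl) (fun _ _ _ => .trans) fun x => ?_
    rw [← decomposeFin_symm_zero_apply_succ]
    exact sameCycle_apply_right.2 .rfl

theorem sameCycle_decomposeFin_symm_zero_zero_iff {u : Fin (n + 1)} :
    (decomposeFin.symm (0, τ)).SameCycle 0 u ↔ u = 0 :=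
  ⟨fun h => (h.eq_of_left (decomposeFin_symm_apply_zero 0 τ)).symm, fun h => h ▸ .rfl⟩

theorem sameCycle_decomposeFin_symm_succ_zero_succ (q : Fin n) :
    (decomposeFin.symm (q.succ, τ)).SameCycle 0 q.succ := by
  have h := sameCycle_apply_right.2 (SameCycle.refl (decomposeFin.symm (q.succ, τ)) 0)
  rwa [decomposeFin_symm_apply_zero] at h

theorem sameCycle_decomposeFin_symm_succ_succ_iff {q x y : Fin n} :
    (decomposeFin.symm (q.succ, τ)).SameCycle x.succ y.succ ↔ τ.SameCycle x y := by
  refine ⟨fun h => ?_, fun h => ?_⟩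
  · let π : Fin (n + 1) → Fin n := Fin.cases q id
    refine h.rel_of_forall_rel_apply (r := fun u v => τ.SameCycle (π u) (π v))
      (fun _ => .rfl) (fun _ _ _ => .trans) fun u => ?_
    cases u using Fin.cases with
    | zero => simp [π, SameCycle.rfl]
    | succ x =>
      have hπ : π (decomposeFin.symm (q.succ, τ) x.succ) = τ x := by
        rw [decomposeFin_symm_succ_apply_succ]
        split_ifs with hx
        · exact hx.symm
        · rfl
      rw [hπ]
      exact sameCycle_apply_right.2 .rfl
  · refine h.rel_of_forall_rel_apply
      (r := fun x y => (decomposeFin.symm (q.succ, τ)).SameCycle x.succ y.succ)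
      (fun _ => .rfl) (fun _ _ _ => .trans) fun x => ?_
    have hstep := sameCycle_apply_right.2
      (SameCycle.refl (decomposeFin.symm (q.succ, τ)) x.succ)
    rw [decomposeFin_symm_succ_apply_succ] at hstep
    split_ifs at hstep with hx
    · exact hx ▸ hstep.trans (sameCycle_decomposeFin_symm_succ_zero_succ τ q)
    · exact hstep

theorem sameCycle_decomposeFin_symm_succ_zero_succ_iff {q x : Fin n} :
    (decomposeFin.symm (q.succ, τ)).SameCycle 0 x.succ ↔ τ.SameCycle q x := by
  have h := sameCycle_decomposeFin_symm_succ_zero_succ τ q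
  rw [← sameCycle_decomposeFin_symm_succ_succ_iff τ (q := q)]
  exact ⟨h.symm.trans, h.trans⟩

theorem cycCount_decomposeFin_symm_zero :
    cycCount (decomposeFin.symm (0, τ)) = cycCount τ + 1 := by
  rw [cycCount_eq_card_quotient, cycCount_eq_card_quotient, ← Finite.card_option]
  let f : Option (Quotient (SameCycle.setoid τ)) →
      Quotient (SameCycle.setoid (decomposeFin.symm (0, τ))) := fun o =>
    o.elim (Quotient.mk _ 0) (Quotient.map Fin.succ fun _ _ h =>
      (sameCycle_decomposeFin_symm_zero_succ_iff τ).2 h)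
  refine (Nat.card_eq_of_bijective f ⟨?_, ?_⟩).symm
  · rintro (_ | ⟨⟨x⟩⟩) (_ | ⟨⟨y⟩⟩) h
    · rfl
    · exact absurd ((sameCycle_decomposeFin_symm_zero_zero_iff τ).1 (Quotient.exact h))
        (Fin.succ_ne_zero y)
    · exact absurd ((sameCycle_decomposeFin_symm_zero_zero_iff τ).1 (Quotient.exact h.symm))
        (Fin.succ_ne_zero x)
    · exact congrArg some
        (Quotient.sound ((sameCycle_decomposeFin_symm_zero_succ_iff τ).1 (Quotient.exact h)))
  · rintro ⟨u⟩
    cases u using Fin.cases with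
    | zero => exact ⟨none, rfl⟩
    | succ x => exact ⟨some (Quotient.mk _ x), rfl⟩

theorem cycCount_decomposeFin_symm_succ (q : Fin n) :
    cycCount (decomposeFin.symm (q.succ, τ)) = cycCount τ := by
  rw [cycCount_eq_card_quotient, cycCount_eq_card_quotient]
  let f : Quotient (SameCycle.setoid τ) →
      Quotient (SameCycle.setoid (decomposeFin.symm (q.succ, τ))) :=
    Quotient.map Fin.succ fun _ _ h => (sameCycle_decomposeFin_symm_succ_succ_iff τ).2 h
  refine (Nat.card_eq_of_bijective f ⟨?_, ?_⟩).symm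
  · rintro ⟨x⟩ ⟨y⟩ h
    exact Quotient.sound ((sameCycle_decomposeFin_symm_succ_succ_iff τ).1 (Quotient.exact h))
  · rintro ⟨u⟩
    cases u using Fin.cases with
    | zero =>
      exact ⟨Quotient.mk _ q,
        Quotient.sound (sameCycle_decomposeFin_symm_succ_zero_succ τ q).symm⟩
    | succ x => exact ⟨Quotient.mk _ x, rfl⟩

theorem orbLen_decomposeFin_symm_zero : orbLen (decomposeFin.symm (0, τ)) 0 = 1 :=
  Finset.card_eq_one.2 ⟨0, by ext; simp [sameCycle_decomposeFin_symm_zero_zero_iff]⟩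

theorem orbLen_decomposeFin_symm_succ (q : Fin n) :
    orbLen (decomposeFin.symm (q.succ, τ)) 0 = orbLen τ q + 1 := by
  simp only [orbLen, Fin.card_filter_univ_succ, SameCycle.rfl, if_true,
    sameCycle_decomposeFin_symm_succ_zero_succ_iff]

end decomposeFin

theorem cycCount_conj {n : ℕ} (g τ : Perm (Fin n)) : cycCount (g * τ * g⁻¹) = cycCount τ := by
  rw [cycCount, cycCount, cycleType_conj]
  congr 1
  refine (Finset.card_equiv g fun x => ?_).symm
  simp only [Finset.mem_filter_univ]
  simp

theorem orbLen_conj_apply {n : ℕ} (g τ : Perm (Fin n)) (x : Fin n) :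
    orbLen (g * τ * g⁻¹) (g x) = orbLen τ x := by
  refine (Finset.card_equiv g fun y => ?_).symm
  simp [sameCycle_conj]

theorem sum_orbLen_mul_pow_cycCount_eq {n : ℕ} (d : ℕ) (x y : Fin n) :
    ∑ τ : Perm (Fin n), orbLen τ x * d ^ cycCount τ =
      ∑ τ : Perm (Fin n), orbLen τ y * d ^ cycCount τ := by
  refine Fintype.sum_equiv (MulAut.conj (swap x y)).toEquiv _ _ fun τ => ?_
  have h := orbLen_conj_apply (swap x y) τ x
  rw [swap_apply_left] at h
  change _ = orbLen (swap x y * τ * (swap x y)⁻¹) y * d ^ cycCount (swap x y * τ * (swap x y)⁻¹)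
  rw [h, cycCount_conj]

theorem sum_pow_cycCount (n d : ℕ) :
    ∑ τ : Perm (Fin n), d ^ cycCount τ = ∏ i ∈ Finset.range n, (d + i) := by
  induction n with
  | zero => simp [cycCount]
  | succ n ih =>
    rw [← decomposeFin.symm.sum_comp, Fintype.sum_prod_type, Fin.sum_univ_succ]
    simp only [cycCount_decomposeFin_symm_zero, cycCount_decomposeFin_symm_succ, pow_succ,
      ← Finset.sum_mul, ih, Finset.prod_range_succ, Finset.sum_const, Finset.card_univ,
      Fintype.card_fin, smul_eq_mul]
    ring

theorem sum_orbLen_zero_mul_pow_cycCount_succ (n d : ℕ) :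
    ∑ τ : Perm (Fin (n + 1)), orbLen τ 0 * d ^ cycCount τ =
      ∏ i ∈ Finset.range (n + 1), (d + i) +
        ∑ q : Fin n, ∑ τ : Perm (Fin n), orbLen τ q * d ^ cycCount τ := by
  rw [← decomposeFin.symm.sum_comp, Fintype.sum_prod_type, Fin.sum_univ_succ]
  simp only [cycCount_decomposeFin_symm_zero, cycCount_decomposeFin_symm_succ,
    orbLen_decomposeFin_symm_zero, orbLen_decomposeFin_symm_succ, add_mul, one_mul, pow_succ,
    ← Finset.sum_mul, Finset.sum_add_distrib, sum_pow_cycCount, Finset.prod_range_succ,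
    Finset.sum_const, Finset.card_univ, Fintype.card_fin, smul_eq_mul]
  ring

theorem sum_orbLen_pow_cycCount (n d : ℕ) (hn : 1 ≤ n) (hd : 1 ≤ d) :
    (d + 1) * ∑ τ : Equiv.Perm (Fin n), orbLen τ ⟨0, by omega⟩ * d ^ cycCount τ =
      (d + n) * ∏ i ∈ Finset.range n, (d + i) := by
  induction n, hn using Nat.le_induction with
  | base =>
    have h := sum_orbLen_zero_mul_pow_cycCount_succ 0 d
    simp only [Finset.univ_eq_empty, Finset.sum_empty, add_zero, zero_add] at h
    exact congrArg ((d + 1) * ·) h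
  | succ n hn ih =>
    have h := sum_orbLen_zero_mul_pow_cycCount_succ n d
    simp only [sum_orbLen_mul_pow_cycCount_eq d _ (⟨0, hn⟩ : Fin n), Finset.sum_const,
      Finset.card_univ, Fintype.card_fin, smul_eq_mul] at h
    refine (congrArg ((d + 1) * ·) h).trans ?_
    rw [mul_add, mul_left_comm, ih, Finset.prod_range_succ]
    ring
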